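/- Let n and b be integers with n ≥ 0 and b ≥ 1. Then ∑_{k=0}^{n} (-1)^k · C(n,k) / (b+k)^2 = (1/(n+1)) · (H_{n+b} − H_{b−1}) / C(n+b, n+1), where all quotients are taken in ℚ (equivalently ℝ). -/

import Mathlib

/-- Pascal's rule for alternating binomial sums. -/
theorem alternating_sum_choose_succ (f : ℕ → ℚ) (n : ℕ) :
    ∑ k ∈ Finset.range (n + 2), (-1 : ℚ) ^ k * ((n + 1).choose k : ℚ) * f k
      = ∑ k ∈ Finset.range (n + 1), (-1 : ℚ) ^ k * (n.choose k : ℚ) * f k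
        - ∑ k ∈ Finset.range (n + 1), (-1 : ℚ) ^ k * (n.choose k : ℚ) * f (k + 1) := by
  have h : ∑ k ∈ Finset.range (n + 1), (-1 : ℚ) ^ k * (n.choose k : ℚ) * f k
      = ∑ k ∈ Finset.range (n + 2), (-1 : ℚ) ^ k * (n.choose k : ℚ) * f k := by
    rw [Finset.sum_range_succ _ (n + 1)]
    simp
  rw [h, Finset.sum_range_succ', Finset.sum_range_succ' _ (n + 1), add_sub_right_comm,
    ← Finset.sum_sub_distrib]
  congr 1
  · refine Finset.sum_congr rfl fun k _ => ?_
    rw [Nat.choose_succ_succ]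
    push_cast
    ring
  · simp

theorem alternating_sum_inv_sq_factorial (n c : ℕ) :
    ∑ k ∈ Finset.range (n + 1), (-1 : ℚ) ^ k * (n.choose k : ℚ) * (1 / ((c : ℚ) + 1 + k) ^ 2)
      = (harmonic (n + c + 1) - harmonic c)
          * ((n.factorial : ℚ) * c.factorial / (n + c + 1).factorial) := by
  induction n generalizing c with
  | zero =>
    have h1 : (c : ℚ) + 1 ≠ 0 := by positivity
    have h2 : (c.factorial : ℚ) ≠ 0 := by positivity
    simp only [zero_add, Finset.sum_range_one, harmonic_succ, Nat.factorial_succ]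
    push_cast
    simp
    field_simp
  | succ n ih =>
    rw [alternating_sum_choose_succ (fun k => 1 / ((c : ℚ) + 1 + k) ^ 2) n, ih c]
    have h := ih (c + 1)
    have e : ∀ k : ℕ, ((c + 1 : ℕ) : ℚ) + 1 + k = (c : ℚ) + 1 + ((k + 1 : ℕ) : ℚ) := by
      intro k
      push_cast
      ring
    simp only [e] at h
    rw [h, show n + (c + 1) + 1 = n + c + 1 + 1 by ring, show n + 1 + c + 1 = n + c + 1 + 1 by ring,
      harmonic_succ (n + c + 1), harmonic_succ c, Nat.factorial_succ (n + c + 1),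
      Nat.factorial_succ n, Nat.factorial_succ c]
    have h1 : (c : ℚ) + 1 ≠ 0 := by positivity
    have h2 : (n : ℚ) + c + 1 + 1 ≠ 0 := by positivity
    have h3 : ((n + c + 1).factorial : ℚ) ≠ 0 := by positivity
    push_cast
    field_simp
    ring

/- `harmonic m = ∑_{j=1}^m 1/j` is Mathlib's harmonic number `harmonic : ℕ → ℚ`. -/

theorem alternating_sum_inv_sq (n b : ℕ) (hb : 1 ≤ b) :
    ∑ k ∈ Finset.range (n + 1),
        (-1 : ℚ) ^ k * (n.choose k : ℚ) / ((b : ℚ) + k) ^ 2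
      = 1 / ((n : ℚ) + 1) *
          ((harmonic (n + b) - harmonic (b - 1)) / ((n + b).choose (n + 1) : ℚ)) := by
  obtain ⟨c, rfl⟩ := Nat.exists_eq_add_of_le' hb
  have h := alternating_sum_inv_sq_factorial n c
  simp only [mul_one_div] at h
  push_cast
  rw [h, show n + (c + 1) = n + 1 + c by ring,
    show n + c + 1 = n + 1 + c by ring, Nat.cast_add_choose, Nat.factorial_succ n]
  have h1 : (n : ℚ) + 1 ≠ 0 := by positivity
  have h2 : (n.factorial : ℚ) ≠ 0 := by positivity
  have h3 : (c.factorial : ℚ) ≠ 0 := by positivity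
  have h4 : ((n + 1 + c).factorial : ℚ) ≠ 0 := by positivity
  push_cast
  field_simp
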